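/- On the 2-dimensional real ℓ_p space with 1 < p < ∞ and p ≠ 2, with the semi-inner product [x₁e₁+y₁e₂, x₂e₁+y₂e₂] = (|x₂|^p + |y₂|^p)^{-(p-2)/p} · (x₁|x₂|^{p-1}sgn(x₂) + y₁|y₂|^{p-1}sgn(y₂)), the rotation F by angle π/2 (F(x e₁ + y e₂) = y e₁ − x e₂) satisfies [F z, v] = −[z, F v] for all z, v, and hence F is not adjoint abelian. -/

import Mathlib

noncomputable def lpSip (p : ℝ) (z v : ℝ × ℝ) : ℝ :=
  (|v.1| ^ p + |v.2| ^ p) ^ (-(p - 2) / p) *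
    (z.1 * |v.1| ^ (p - 1) * Real.sign v.1 + z.2 * |v.2| ^ (p - 1) * Real.sign v.2)

/-- rotation by π/2 : `F(x,y) = (y, −x)` -/
def rotHalfPi (z : ℝ × ℝ) : ℝ × ℝ := (z.2, -z.1)

theorem lpSip_rotHalfPi_left (p : ℝ) (z v : ℝ × ℝ) :
    lpSip p (rotHalfPi z) v = -(lpSip p z (rotHalfPi v)) := by
  simp only [lpSip, rotHalfPi, abs_neg, Real.sign_neg, add_comm (|v.2| ^ p)]
  ring

/-- On `ℓ_p²` (`1 < p < ∞`, `p ≠ 2`), the rotation by `π/2` satisfies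
`[F z, v] = −[z, F v]` for all `z, v`; hence it is not adjoint abelian. -/
theorem lp_rotation_not_adjoint_abelian (p : ℝ) (hp : 1 < p) (hp2 : p ≠ 2) :
    (∀ z v : ℝ × ℝ, lpSip p (rotHalfPi z) v = -(lpSip p z (rotHalfPi v))) ∧
    ¬ (∀ z v : ℝ × ℝ, lpSip p (rotHalfPi z) v = lpSip p z (rotHalfPi v)) := by
  refine ⟨lpSip_rotHalfPi_left p, fun h => ?_⟩
  have value_eq_one : lpSip p (rotHalfPi (0, 1)) (1, 0) = 1 := by
    have p_ne_zero : p ≠ 0 := by linarith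
    simp [lpSip, rotHalfPi, Real.zero_rpow p_ne_zero]
  linarith [h (0, 1) (1, 0), lpSip_rotHalfPi_left p (0, 1) (1, 0)]
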